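/- Let Ω ⊂ ℂ^q be a bounded domain (nonempty, open, connected, bounded) and let z ∈ Ω. Then there exists an injective holomorphic map φ : Ω → B^q with φ(z) = 0 such that sup{r > 0 : B(0,r) ⊆ φ(Ω)} = S_Ω(z), i.e., the supremum defining the squeezing function at z is attained. -/

import Mathlib

open Metric

/-- For an injective holomorphic `φ : Ω → 𝔹^q` with `φ z = 0`, the quantity
`S_{Ω,φ}(z) = sup { r > 0 : B(0,r) ⊆ φ(Ω) }`. -/
noncomputable def SOmegaPhi (q : ℕ) (Ω : Set (EuclideanSpace ℂ (Fin q)))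
    (φ : EuclideanSpace ℂ (Fin q) → EuclideanSpace ℂ (Fin q)) : ℝ :=
  sSup {r : ℝ | 0 < r ∧ ball (0 : EuclideanSpace ℂ (Fin q)) r ⊆ φ '' Ω}

/-- The squeezing function `S_Ω(z)`: the supremum of `S_{Ω,φ}(z)` over all injective
holomorphic maps `φ : Ω → 𝔹^q` with `φ z = 0`. -/
noncomputable def SOmega (q : ℕ) (Ω : Set (EuclideanSpace ℂ (Fin q)))
    (z : EuclideanSpace ℂ (Fin q)) : ℝ :=
  sSup {s : ℝ | ∃ φ : EuclideanSpace ℂ (Fin q) → EuclideanSpace ℂ (Fin q),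
    DifferentiableOn ℂ φ Ω ∧ Set.InjOn φ Ω ∧
    Set.MapsTo φ Ω (ball (0 : EuclideanSpace ℂ (Fin q)) 1) ∧ φ z = 0 ∧
    s = SOmegaPhi q Ω φ}


section
open Metric Filter Topology Set

/-- Locally bounded, pointwise convergence of holomorphic maps. -/
def HolConv {ι E F : Type*} [NormedAddCommGroup E] [NormedSpace ℂ E]
    [NormedAddCommGroup F] [NormedSpace ℂ F] (l : Filter ι) (f : ι → E → F) (g : E → F)
    (U : Set E) : Prop :=
  ∀ x ∈ U, ∃ R > 0, ∃ M : ℝ, ball x R ⊆ U ∧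
    (∀ᶠ n in l, DifferentiableOn ℂ (f n) (ball x R) ∧ ∀ y ∈ ball x R, ‖f n y‖ ≤ M) ∧
    ∀ y ∈ ball x R, Tendsto (fun n => f n y) l (𝓝 (g y))

set_option linter.unusedSectionVars false

section
variable {ι E F : Type*} [NormedAddCommGroup E] [NormedSpace ℂ E]
    [NormedAddCommGroup F] [NormedSpace ℂ F]

lemma cauchy_fderiv {f : E → F} {x : E} {R M : ℝ} (hR : 0 < R)
    (hd : DifferentiableOn ℂ f (ball x R)) (hM : ∀ y ∈ ball x R, ‖f y‖ ≤ M) :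
    ‖fderiv ℂ f x‖ ≤ 2 * M / R := by
  refine Complex.norm_fderiv_le_div_of_mapsTo_ball hd ?_ hR
  intro y hy
  rw [mem_closedBall, dist_eq_norm]
  have h1 := hM y hy
  have h2 := hM x (mem_ball_self hR)
  have := norm_sub_le (f y) (f x)
  linarith

lemma ball_sub_of_half {x y : E} {R : ℝ} (hy : y ∈ ball x (R/2)) : ball y (R/2) ⊆ ball x R := by
  intro w hw
  rw [mem_ball] at *
  have := dist_triangle w y x
  linarith

lemma cauchy_fderiv' {f : E → F} {x : E} {R M : ℝ} (hR : 0 < R)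
    (hd : DifferentiableOn ℂ f (ball x R)) (hM : ∀ y ∈ ball x R, ‖f y‖ ≤ M) :
    ∀ y ∈ ball x (R/2), ‖fderiv ℂ f y‖ ≤ 4 * M / R := by
  intro y hy
  have hs := ball_sub_of_half hy
  have := cauchy_fderiv (half_pos hR) (hd.mono hs) (fun w hw => hM w (hs hw))
  refine this.trans (le_of_eq ?_)
  field_simp
  ring

lemma cauchy_lip {f : E → F} {x : E} {R M : ℝ} (hR : 0 < R)
    (hd : DifferentiableOn ℂ f (ball x R)) (hM : ∀ y ∈ ball x R, ‖f y‖ ≤ M) :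
    ∀ y ∈ ball x (R/2), ∀ w ∈ ball x (R/2), ‖f w - f y‖ ≤ 4 * M / R * ‖w - y‖ := by
  intro y hy w hw
  refine (convex_ball x (R/2)).norm_image_sub_le_of_norm_fderiv_le (𝕜 := ℂ) ?_
    (cauchy_fderiv' hR hd hM) hy hw
  intro u hu
  exact hd.differentiableAt (isOpen_ball.mem_nhds (ball_subset_ball (by linarith) hu))

lemma local_unif [FiniteDimensional ℂ E] {l : Filter ι} [l.NeBot] {f : ι → E → F} {g : E → F}
    {x : E} {R M : ℝ} (hR : 0 < R)
    (h : ∀ᶠ n in l, DifferentiableOn ℂ (f n) (ball x R) ∧ ∀ y ∈ ball x R, ‖f n y‖ ≤ M)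
    (ht : ∀ y ∈ ball x R, Tendsto (fun n => f n y) l (𝓝 (g y))) :
    TendstoUniformlyOn f g l (ball x (R/2)) := by
  have : ProperSpace E := FiniteDimensional.proper ℂ E
  have hM : 0 ≤ M := by
    obtain ⟨n, hn⟩ := h.exists
    exact (norm_nonneg _).trans (hn.2 x (mem_ball_self hR))
  set K := 4 * M / R with hK
  have hK0 : 0 ≤ K := by positivity
  have hsub : ball x (R/2) ⊆ ball x R := ball_subset_ball (by linarith)
  have hl : ∀ᶠ n in l, ∀ y ∈ ball x (R/2), ∀ w ∈ ball x (R/2), ‖f n w - f n y‖ ≤ K * ‖w - y‖ := by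
    filter_upwards [h] with n hn
    exact cauchy_lip hR hn.1 hn.2
  have hg : ∀ y ∈ ball x (R/2), ∀ w ∈ ball x (R/2), ‖g w - g y‖ ≤ K * ‖w - y‖ := by
    intro y hy w hw
    refine le_of_tendsto (((ht w (hsub hw)).sub (ht y (hsub hy))).norm) ?_
    filter_upwards [hl] with n hn using hn y hy w hw
  rw [Metric.tendstoUniformlyOn_iff]
  intro ε hε
  have htb : TotallyBounded (ball x (R/2)) := (isCompact_closedBall x (R/2)).totallyBounded.subset ball_subset_closedBall
  obtain ⟨t, hts, htf, htc⟩ := finite_approx_of_totallyBounded htb (ε / (4 * (K + 1))) (by positivity)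
  have hfin : ∀ᶠ n in l, ∀ c ∈ t, dist (f n c) (g c) < ε / 4 := by
    rw [htf.eventually_all]
    intro c hc
    exact (ht c (hsub (hts hc))) (Metric.ball_mem_nhds _ (by positivity))
  filter_upwards [hl, hfin] with n h1 h2 y hy
  obtain ⟨c, hc, hyc⟩ := mem_iUnion₂.1 (htc hy)
  rw [mem_ball, dist_eq_norm] at hyc
  have e1 := hg c (hts hc) y hy
  have e2 := h1 c (hts hc) y hy
  have e3 := h2 c hc
  have e4 : K * ‖y - c‖ ≤ ε / 4 := by
    calc K * ‖y - c‖ ≤ (K + 1) * (ε / (4 * (K + 1))) := by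
          gcongr; linarith
      _ = ε / 4 := by field_simp
  rw [dist_eq_norm] at e3 ⊢
  have : g y - f n y = (g y - g c) - (f n y - f n c) - (f n c - g c) := by abel
  rw [this]
  have q1 := norm_sub_le ((g y - g c) - (f n y - f n c)) (f n c - g c)
  have q2 := norm_sub_le (g y - g c) (f n y - f n c)
  linarith

lemma local_unif_fderiv [FiniteDimensional ℂ E] [CompleteSpace F]
    {l : Filter ι} [l.NeBot] {f : ι → E → F} {g : E → F}
    {x : E} {R M : ℝ} (hR : 0 < R)
    (h : ∀ᶠ n in l, DifferentiableOn ℂ (f n) (ball x R) ∧ ∀ y ∈ ball x R, ‖f n y‖ ≤ M)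
    (ht : ∀ y ∈ ball x R, Tendsto (fun n => f n y) l (𝓝 (g y))) :
    TendstoUniformlyOn (fun n => fderiv ℂ (f n)) (fderiv ℂ g) l (ball x (R/4)) ∧
      ∀ y ∈ ball x (R/4), DifferentiableAt ℂ g y := by
  have hu := local_unif hR h ht
  have hq : ∀ y ∈ ball x (R/4), ball y (R/4) ⊆ ball x (R/2) := by
    intro y hy
    have : R/4 = R/2/2 := by ring
    rw [this] at hy ⊢
    exact ball_sub_of_half hy
  have hsub : ball x (R/2) ⊆ ball x R := ball_subset_ball (by linarith)
  have hsub4 : ball x (R/4) ⊆ ball x R := ball_subset_ball (by linarith)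
  have hC : UniformCauchySeqOn (fun n => fderiv ℂ (f n)) l (ball x (R/4)) := by
    have hu' := hu.uniformCauchySeqOn
    intro u hu
    obtain ⟨ε, hε, hεu⟩ := Metric.mem_uniformity_dist.1 hu
    have h1 := hu' _ (Metric.dist_mem_uniformity (show 0 < ε * R / 16 by positivity))
    filter_upwards [h1, h.prod_mk h] with ⟨n, m⟩ h1 h2 y hy
    apply hεu
    simp only at h1 h2 ⊢
    have dn : DifferentiableOn ℂ (f n) (ball y (R/4)) := h2.1.1.mono ((hq y hy).trans hsub)
    have dm : DifferentiableOn ℂ (f m) (ball y (R/4)) := h2.2.1.mono ((hq y hy).trans hsub)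
    have hy' : ball y (R/4) ∈ 𝓝 y := ball_mem_nhds y (by positivity)
    have hb := cauchy_fderiv (f := f n - f m) (x := y) (R := R/4) (M := ε * R / 16) (by positivity)
      (dn.sub dm) (by
        intro w hw
        have := h1 w (hq y hy hw)
        rw [dist_eq_norm] at this
        exact this.le)
    rw [fderiv_sub (dn.differentiableAt hy') (dm.differentiableAt hy')] at hb
    rw [dist_eq_norm]
    refine hb.trans_lt ?_
    have : 2 * (ε * R / 16) / (R/4) = ε / 2 := by field_simp; ring
    linarith
  have hlim : ∀ y ∈ ball x (R/4), ∃ A, Tendsto (fun n => fderiv ℂ (f n) y) l (𝓝 A) := by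
    intro y hy
    exact cauchy_map_iff_exists_tendsto.1 (hC.cauchy_map hy)
  choose! A hA using hlim
  have hU := hC.tendstoUniformlyOn_of_tendsto hA
  have hder : ∀ y ∈ ball x (R/4), HasFDerivAt g (A y) y := by
    intro y hy
    have hny : ball x (R/4) ∈ 𝓝 y := isOpen_ball.mem_nhds hy
    refine hasFDerivAt_of_tendstoUniformlyOnFilter (l := l) (f := f)
      (f' := fun n => fderiv ℂ (f n)) ?_ ?_ ?_
    · exact (tendstoUniformlyOn_iff_tendstoUniformlyOnFilter.1 hU).mono_right
        (le_principal_iff.2 hny)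
    · filter_upwards [h.prod_mk (show ∀ᶠ w in 𝓝 y, w ∈ ball x (R/4) from hny)] with ⟨n, w⟩ hw
      exact (hw.1.1.differentiableAt (isOpen_ball.mem_nhds (hsub4 hw.2))).hasFDerivAt
    · filter_upwards [hny] with w hw using ht w (hsub4 hw)
  refine ⟨?_, fun y hy => (hder y hy).differentiableAt⟩
  refine hU.congr_right ?_
  intro y hy
  exact ((hder y hy).fderiv).symm

lemma HolConv.mono {l : Filter ι} {f : ι → E → F} {g : E → F} {U V : Set E}
    (h : HolConv l f g U) (hV : IsOpen V) (hVU : V ⊆ U) : HolConv l f g V := by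
  intro x hx
  obtain ⟨R, hR, M, h1, h2, h3⟩ := h x (hVU hx)
  obtain ⟨r, hr, hrV⟩ := Metric.isOpen_iff.1 hV x hx
  have hs : ball x (min R r) ⊆ ball x R := ball_subset_ball (min_le_left _ _)
  refine ⟨min R r, lt_min hR hr, M, (ball_subset_ball (min_le_right _ _)).trans hrV, ?_,
    fun y hy => h3 y (hs hy)⟩
  filter_upwards [h2] with n hn
  exact ⟨hn.1.mono hs, fun y hy => hn.2 y (hs hy)⟩

lemma HolConv.differentiableOn [FiniteDimensional ℂ E] [CompleteSpace F] {l : Filter ι} [l.NeBot]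
    {f : ι → E → F} {g : E → F} {U : Set E} (h : HolConv l f g U) : DifferentiableOn ℂ g U := by
  intro x hx
  obtain ⟨R, hR, M, h1, h2, h3⟩ := h x hx
  exact ((local_unif_fderiv hR h2 h3).2 x (mem_ball_self (by positivity))).differentiableWithinAt

lemma HolConv.tendsto {l : Filter ι} {f : ι → E → F} {g : E → F} {U : Set E}
    (h : HolConv l f g U) : ∀ x ∈ U, Tendsto (fun n => f n x) l (𝓝 (g x)) := by
  intro x hx
  obtain ⟨R, hR, M, h1, h2, h3⟩ := h x hx
  exact h3 x (mem_ball_self hR)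

lemma HolConv.unif [FiniteDimensional ℂ E] {l : Filter ι} [l.NeBot]
    {f : ι → E → F} {g : E → F} {U : Set E} (h : HolConv l f g U) :
    ∀ x ∈ U, ∃ r > 0, ball x r ⊆ U ∧ TendstoUniformlyOn f g l (ball x r) := by
  intro x hx
  obtain ⟨R, hR, M, h1, h2, h3⟩ := h x hx
  exact ⟨R/2, by positivity, (ball_subset_ball (by linarith)).trans h1, local_unif hR h2 h3⟩

lemma bounded_near {f : E → F} {U : Set E} (hU : IsOpen U) (hf : DifferentiableOn ℂ f U) {x : E}
    (hx : x ∈ U) : ∃ R > 0, ball x R ⊆ U ∧ ∃ M : ℝ, ∀ y ∈ ball x R, ‖f y‖ ≤ M := by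
  have hc : ContinuousAt f x := hf.continuousOn.continuousAt (hU.mem_nhds hx)
  have h1 := hc (ball_mem_nhds (f x) one_pos)
  obtain ⟨R, hR, h⟩ := Metric.mem_nhds_iff.1 (inter_mem h1 (hU.mem_nhds hx))
  refine ⟨R, hR, fun y hy => (h hy).2, ‖f x‖ + 1, fun y hy => ?_⟩
  have h2 : dist (f y) (f x) < 1 := (h hy).1
  rw [dist_eq_norm] at h2
  have := norm_sub_norm_le (f y) (f x)
  linarith

lemma differentiableOn_clm {X : Type*} [NormedAddCommGroup X] [NormedSpace ℂ X]
    [FiniteDimensional ℂ E] {A : X → E →L[ℂ] F} {U : Set X}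
    (h : ∀ v, DifferentiableOn ℂ (fun x => A x v) U) : DifferentiableOn ℂ A U := by
  let b := Module.finBasis ℂ E
  have : A = fun x => ∑ i, ContinuousLinearMap.smulRightL ℂ E F
      (LinearMap.toContinuousLinearMap (b.coord i)) (A x (b i)) := by
    funext x
    ext v
    conv_lhs => rw [← b.sum_repr v, map_sum]
    simp
  rw [this]
  refine DifferentiableOn.fun_sum fun i _ => ?_
  exact (ContinuousLinearMap.differentiable _).comp_differentiableOn (h (b i))

lemma differentiableOn_fderiv [FiniteDimensional ℂ E] [CompleteSpace F] {f : E → F} {U : Set E}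
    (hU : IsOpen U) (hf : DifferentiableOn ℂ f U) : DifferentiableOn ℂ (fderiv ℂ f) U := by
  refine differentiableOn_clm fun v => ?_
  have : HolConv (𝓝[≠] (0:ℂ)) (fun s y => s⁻¹ • (f (y + s • v) - f y))
      (fun y => fderiv ℂ f y v) U := by
    intro x hx
    obtain ⟨R, hR, hRU, M, hM⟩ := bounded_near hU hf hx
    have hs : ball x (R/4) ⊆ ball x (R/2) := ball_subset_ball (by linarith)
    have hs' : ball x (R/2) ⊆ ball x R := ball_subset_ball (by linarith)
    have hev : ∀ᶠ s : ℂ in 𝓝[≠] 0, ‖s • v‖ < R/4 := by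
      have : Tendsto (fun s : ℂ => ‖s • v‖) (𝓝[≠] 0) (𝓝 ‖(0:ℂ) • v‖) :=
        ((continuous_id.smul continuous_const).norm.tendsto 0).mono_left nhdsWithin_le_nhds
      rw [zero_smul, norm_zero] at this
      exact this.eventually (gt_mem_nhds (by positivity))
    have hadd : ∀ s : ℂ, ‖s • v‖ < R/4 → ∀ y ∈ ball x (R/4), y + s • v ∈ ball x (R/2) := by
      intro s hs y hy
      rw [mem_ball, dist_eq_norm] at *
      have := norm_add_le (y - x) (s • v)
      rw [show y + s • v - x = (y - x) + s • v by abel]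
      linarith
    refine ⟨R/4, by positivity, 4 * M / R * ‖v‖, (hs.trans hs').trans hRU, ?_, ?_⟩
    · filter_upwards [hev, self_mem_nhdsWithin] with s h1 h0
      have h0 : s ≠ 0 := h0
      constructor
      · refine DifferentiableOn.const_smul (DifferentiableOn.sub ?_ ?_) _
        · refine hf.comp (t := U) (by fun_prop) ?_
          intro y hy
          exact hRU (hs' (hadd s h1 y hy))
        · exact hf.mono ((hs.trans hs').trans hRU)
      · intro y hy
        have := cauchy_lip hR (hf.mono hRU) hM y (hs hy) _ (hadd s h1 y hy)
        rw [norm_smul, norm_inv]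
        rw [add_sub_cancel_left, norm_smul] at this
        have hp : 0 < ‖s‖ := norm_pos_iff.2 h0
        rw [inv_mul_le_iff₀ hp]
        linarith
    · intro y hy
      have hd : HasFDerivAt f (fderiv ℂ f y) y :=
        (hf.differentiableAt (hU.mem_nhds (hRU (hs' (hs hy))))).hasFDerivAt
      have := (hd.hasLineDerivAt v).tendsto_slope_zero
      exact this
  exact this.differentiableOn

lemma contDiffOn_of_hol [FiniteDimensional ℂ E] [CompleteSpace F] {f : E → F} {U : Set E}
    (hU : IsOpen U) (hf : DifferentiableOn ℂ f U) : ContDiffOn ℂ 1 f U := by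
  rw [show (1 : WithTop ℕ∞) = 0 + 1 by simp, contDiffOn_succ_iff_fderiv_of_isOpen hU]
  refine ⟨hf, by simp, ?_⟩
  rw [contDiffOn_zero]
  exact (differentiableOn_fderiv hU hf).continuousOn

lemma contDiffAt_of_hol [FiniteDimensional ℂ E] [CompleteSpace F] {f : E → F} {U : Set E}
    (hU : IsOpen U) (hf : DifferentiableOn ℂ f U) {x : E} (hx : x ∈ U) : ContDiffAt ℂ 1 f x :=
  (contDiffOn_of_hol hU hf).contDiffAt (hU.mem_nhds hx)

lemma HolConv.fderiv [FiniteDimensional ℂ E] [CompleteSpace F] {l : Filter ι} [l.NeBot]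
    {f : ι → E → F} {g : E → F} {U : Set E} (h : HolConv l f g U) :
    HolConv l (fun n => fderiv ℂ (f n)) (fderiv ℂ g) U := by
  intro x hx
  obtain ⟨R, hR, M, h1, h2, h3⟩ := h x hx
  have hs : ball x (R/4) ⊆ ball x (R/2) := ball_subset_ball (by linarith)
  have hs' : ball x (R/2) ⊆ ball x R := ball_subset_ball (by linarith)
  refine ⟨R/4, by positivity, 4 * M / R, (hs.trans hs').trans h1, ?_, ?_⟩
  · filter_upwards [h2] with n hn
    exact ⟨(differentiableOn_fderiv isOpen_ball hn.1).mono (hs.trans hs'),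
      fun y hy => cauchy_fderiv' hR hn.1 hn.2 y (hs hy)⟩
  · intro y hy
    exact (local_unif_fderiv hR h2 h3).1.tendsto_at hy

lemma differentiable_det [FiniteDimensional ℂ E] :
    Differentiable ℂ (fun A : E →L[ℂ] E => A.det) := by
  let b := Module.finBasis ℂ E
  have : (fun A : E →L[ℂ] E => A.det) = fun A => ∑ σ : Equiv.Perm (Fin (Module.finrank ℂ E)),
      ((Equiv.Perm.sign σ : ℤ) : ℂ) * ∏ i, b.repr (A (b i)) (σ i) := by
    funext A
    rw [ContinuousLinearMap.det, ← LinearMap.det_toMatrix b, Matrix.det_apply']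
    simp [LinearMap.toMatrix_apply]
  rw [this]
  refine Differentiable.fun_sum fun σ _ => (differentiable_const _).mul ?_
  refine (contDiff_prod (n := 1) (f := fun i (A : E →L[ℂ] E) => b.repr (A (b i)) (σ i))
    fun i _ => ?_).differentiable (by simp)
  have : (fun A : E →L[ℂ] E => b.repr (A (b i)) (σ i)) = fun A =>
    (LinearMap.toContinuousLinearMap (b.coord (σ i))) (A (b i)) := by
    funext A; simp
  rw [this]
  fun_prop

lemma HolConv.det [FiniteDimensional ℂ E] {l : Filter ι}
    {f : ι → E → E →L[ℂ] E} {g : E → E →L[ℂ] E} {U : Set E} (h : HolConv l f g U) :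
    HolConv l (fun n x => (f n x).det) (fun x => (g x).det) U := by
  intro x hx
  obtain ⟨R, hR, M, h1, h2, h3⟩ := h x hx
  have : ProperSpace (E →L[ℂ] E) := FiniteDimensional.proper ℂ _
  obtain ⟨C, hC⟩ := (isCompact_closedBall (0 : E →L[ℂ] E) M).exists_bound_of_continuousOn
    (differentiable_det.continuous.continuousOn)
  refine ⟨R, hR, C, h1, ?_, ?_⟩
  · filter_upwards [h2] with n hn
    exact ⟨(differentiable_det (E := E)).comp_differentiableOn (f := f n) hn.1,
      fun y hy => hC _ (by simpa using hn.2 y hy)⟩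
  · intro y hy
    exact (differentiable_det.continuous.tendsto _).comp (h3 y hy)
end

open Metric Filter Topology Set

lemma min_modulus {g : ℂ → ℂ} {ρ δ : ℝ} (hρ : 0 < ρ) (hδ : 0 < δ)
    (hg : DifferentiableOn ℂ g (closedBall 0 ρ)) (h0 : ∀ t ∈ closedBall (0:ℂ) ρ, g t ≠ 0)
    (hs : ∀ t ∈ sphere (0:ℂ) ρ, δ ≤ ‖g t‖) : δ ≤ ‖g 0‖ := by
  have hd : DiffContOnCl ℂ (fun t => (g t)⁻¹) (ball 0 ρ) := by
    refine DifferentiableOn.diffContOnCl ?_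
    rw [closure_ball _ hρ.ne']
    exact hg.inv h0
  have := Complex.norm_le_of_forall_mem_frontier_norm_le (U := ball (0:ℂ) ρ) isBounded_ball hd
    (C := δ⁻¹) (by
      intro t ht
      rw [frontier_ball _ hρ.ne'] at ht
      rw [norm_inv]
      exact inv_anti₀ hδ (hs t ht)) (z := 0) (subset_closure (mem_ball_self hρ))
  rw [norm_inv] at this
  have hp : 0 < ‖g 0‖ := norm_pos_iff.2 (h0 0 (by simp [hρ.le]))
  exact (inv_le_inv₀ hp hδ).1 this

/-- one variable: vanishing derivative contradicts injectivity -/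
lemma inj_deriv_ne_zero {f : ℂ → ℂ} {U : Set ℂ} (hU : IsOpen U) (hf : DifferentiableOn ℂ f U)
    (hi : InjOn f U) {p : ℂ} (hp : p ∈ U) : deriv f p ≠ 0 := by
  intro h0
  have hUn := hU.mem_nhds hp
  have ha : AnalyticAt ℂ f p := hf.analyticAt hUn
  have ha' : AnalyticAt ℂ (fun t => f t - f p) p := ha.sub analyticAt_const
  have hfin : analyticOrderAt (fun t => f t - f p) p ≠ ⊤ := by
    intro ht
    rw [analyticOrderAt_eq_top] at ht
    have h1 : ∀ᶠ t in 𝓝[≠] p, t ∈ U ∧ f t - f p = 0 ∧ t ≠ p := by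
      filter_upwards [nhdsWithin_le_nhds hUn, nhdsWithin_le_nhds ht, self_mem_nhdsWithin]
        with t h1 h2 h3 using ⟨h1, h2, h3⟩
    obtain ⟨t, h1, h2, h3⟩ := h1.exists
    exact h3 (hi h1 hp (sub_eq_zero.1 h2))
  obtain ⟨m, hm⟩ := ENat.ne_top_iff_exists.1 hfin
  obtain ⟨g, hga, hg0, hfg⟩ := (ha'.analyticOrderAt_eq_natCast).1 hm.symm
  have hm2 : 2 ≤ m := by
    have := (natCast_le_analyticOrderAt_iff_iteratedDeriv_eq_zero ha' (n := 2)).2 (by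
      intro i hi
      interval_cases i
      · simp
      · simp [iteratedDeriv_one, h0])
    rw [← hm] at this
    exact_mod_cast this
  have hm0 : m ≠ 0 := by omega
  obtain ⟨c, hc⟩ := IsAlgClosed.exists_pow_nat_eq (g p) (Nat.pos_of_ne_zero hm0)
  have hc0 : c ≠ 0 := by
    rintro rfl
    rw [zero_pow hm0] at hc
    exact hg0 hc.symm
  let k : ℂ → ℂ := fun t => c * (g t / g p) ^ ((m:ℂ)⁻¹)
  have hk : DifferentiableAt ℂ k p := by
    refine DifferentiableAt.const_mul ?_ c
    refine DifferentiableAt.cpow_const (hga.differentiableAt.div_const _) ?_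
    rw [div_self hg0]
    exact Complex.one_mem_slitPlane
  have hkA : AnalyticAt ℂ k p := by
    refine analyticAt_const.mul ?_
    refine AnalyticAt.cpow (hga.div analyticAt_const hg0) analyticAt_const ?_
    rw [div_self hg0]
    exact Complex.one_mem_slitPlane
  have hkp : k p = c := by simp [k, div_self hg0]
  have hkm : ∀ t, k t ^ m = g t := by
    intro t
    simp only [k, mul_pow, hc]
    rw [← Complex.cpow_nat_mul, mul_inv_cancel₀ (by exact_mod_cast hm0), Complex.cpow_one]
    field_simp
  let w : ℂ → ℂ := fun t => (t - p) * k t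
  have hwA : AnalyticAt ℂ w p := (analyticAt_id.sub analyticAt_const).mul hkA
  have hwd : HasStrictDerivAt w c p := by
    have h1 := hwA.hasStrictDerivAt
    have h2 : HasDerivAt w (1 * k p + (p - p) * deriv k p) p :=
      ((hasDerivAt_id p).sub_const p).mul hk.hasDerivAt
    rw [h2.deriv] at h1
    simpa [hkp] using h1
  have hmap := hwd.map_nhds_eq hc0
  have hwp : w p = 0 := by simp [w]
  rw [hwp] at hmap
  set N : Set ℂ := {t | t ∈ U ∧ f t - f p = w t ^ m} with hN
  have hNn : N ∈ 𝓝 p := by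
    filter_upwards [hUn, hfg] with t h1 h2
    refine ⟨h1, ?_⟩
    rw [h2, smul_eq_mul]
    simp only [w, mul_pow, hkm]
  have hWN : w '' N ∈ 𝓝 (0:ℂ) := hmap ▸ image_mem_map hNn
  obtain ⟨ζ, hζ⟩ : ∃ ζ : ℂ, IsPrimitiveRoot ζ m := ⟨_, Complex.isPrimitiveRoot_exp m hm0⟩
  have hζ1 : ζ ≠ 1 := hζ.ne_one (by omega)
  have hζN : ∀ᶠ s in 𝓝 (0:ℂ), ζ * s ∈ w '' N := by
    have : Tendsto (fun s : ℂ => ζ * s) (𝓝 0) (𝓝 (ζ * 0)) := (continuous_const_mul ζ).tendsto 0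
    rw [mul_zero] at this
    exact this hWN
  have hex : ∀ᶠ s in 𝓝[≠] (0:ℂ), s ∈ w '' N ∧ ζ * s ∈ w '' N ∧ s ≠ 0 := by
    filter_upwards [nhdsWithin_le_nhds hWN, nhdsWithin_le_nhds hζN, self_mem_nhdsWithin]
      with s h1 h2 h3 using ⟨h1, h2, h3⟩
  obtain ⟨s, ⟨t1, ht1, e1⟩, ⟨t2, ht2, e2⟩, hs0⟩ := hex.exists
  have : t1 = t2 := by
    refine hi ht1.1 ht2.1 (sub_left_injective (b := f p) ?_)
    show f t1 - f p = f t2 - f p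
    rw [ht1.2, ht2.2, e1, e2, mul_pow, hζ.pow_eq_one, one_mul]
  rw [this, e2] at e1
  apply hζ1
  have : (ζ - 1) * s = 0 := by linear_combination e1
  rcases mul_eq_zero.1 this with h | h
  · exact sub_eq_zero.1 h
  · exact absurd h hs0

open Metric Filter Topology Set

set_option linter.unusedSectionVars false

section
variable {E : Type*} [NormedAddCommGroup E] [NormedSpace ℂ E] [FiniteDimensional ℂ E]

lemma straighten {U : Set E} (hU : IsOpen U) {u : E → ℂ} (hu : DifferentiableOn ℂ u U) {x₀ v : E}
    (hx : x₀ ∈ U) (h0 : u x₀ = 0) (hv : fderiv ℂ u x₀ v = 1) :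
    (∃ H : E → E, ∃ r > 0, DifferentiableOn ℂ H (ball 0 r) ∧ H 0 = x₀ ∧
      MapsTo H (ball 0 r) U ∧ (∀ y ∈ ball (0:E) r, u (H y) = fderiv ℂ u x₀ y) ∧
      InjOn H (ball 0 r) ∧ HasFDerivAt H (ContinuousLinearMap.id ℂ E) 0) ∧
    ∃ N ∈ 𝓝 x₀, ∀ a ∈ N, ∀ t : ℂ, a + t • v ∈ N → u a = u (a + t • v) → t = 0 := by
  have : CompleteSpace E := FiniteDimensional.complete ℂ E
  set ℓ := fderiv ℂ u x₀ with hℓ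
  let G : E → E := fun x => (x - x₀) + (u x - ℓ (x - x₀)) • v
  have hGx : G x₀ = 0 := by simp [G, h0]
  have hv0 : v ≠ 0 := by rintro rfl; simp at hv
  have hℓG : ∀ x, ℓ (G x) = u x := by intro x; simp [G, hv]
  have hGd : DifferentiableOn ℂ G U := by
    refine DifferentiableOn.add (by fun_prop) (DifferentiableOn.smul_const (hu.sub (by fun_prop)) v)
  have hGc : ContDiffAt ℂ 1 G x₀ := contDiffAt_of_hol hU hGd hx
  have hG' : HasFDerivAt G ((ContinuousLinearEquiv.refl ℂ E : E ≃L[ℂ] E) : E →L[ℂ] E) x₀ := by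
    have h1 : HasFDerivAt u ℓ x₀ := (hu.differentiableAt (hU.mem_nhds hx)).hasFDerivAt
    have h2 : HasFDerivAt (fun x => x - x₀) (ContinuousLinearMap.id ℂ E) x₀ :=
      (hasFDerivAt_id x₀).sub_const x₀
    have h3 : HasFDerivAt (fun x => ℓ (x - x₀)) ℓ x₀ := by
      exact ℓ.hasFDerivAt.comp x₀ h2
    have h4 := h2.add ((h1.sub h3).smul_const v)
    have h5 : ((ContinuousLinearEquiv.refl ℂ E : E ≃L[ℂ] E) : E →L[ℂ] E)
        = ContinuousLinearMap.id ℂ E + (ℓ - ℓ).smulRight v := by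
      ext w
      simp
    rw [h5]
    exact h4
  have hstr := hGc.hasStrictFDerivAt' hG' one_ne_zero
  set H := hstr.localInverse G _ x₀ with hH
  have hHc : ContDiffAt ℂ 1 H 0 := by
    have := hGc.to_localInverse hG' one_ne_zero
    rw [hGx] at this
    exact this
  have hH0 : H 0 = x₀ := by
    have := hstr.localInverse_apply_image
    rwa [hGx] at this
  have hright : ∀ᶠ y in 𝓝 (0:E), G (H y) = y := by
    have := hstr.eventually_right_inverse
    rwa [hGx] at this
  have hHd : ∀ᶠ y in 𝓝 (0:E), DifferentiableAt ℂ H y := by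
    filter_upwards [hHc.eventually (by simp)] with y hy using hy.differentiableAt (by simp)
  have hHU : ∀ᶠ y in 𝓝 (0:E), H y ∈ U := by
    refine hHc.continuousAt.eventually ?_
    rw [hH0]; exact hU.mem_nhds hx
  constructor
  · obtain ⟨r, hr, hb⟩ := Metric.mem_nhds_iff.1 (hright.and (hHd.and hHU))
    refine ⟨H, r, hr, fun y hy => (hb hy).2.1.differentiableWithinAt, hH0,
      fun y hy => (hb hy).2.2, ?_, ?_, ?_⟩
    · intro y hy
      rw [← hℓG, (hb hy).1]
    · intro y hy y' hy' h
      rw [← (hb hy).1, ← (hb hy').1, h]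
    · have := hstr.to_localInverse.hasFDerivAt
      rw [hGx] at this
      exact this
  · have hinj := hstr.eventually_left_inverse
    refine ⟨_, hinj, ?_⟩
    intro a ha t hat hua
    have : G (a + t • v) = G a := by
      simp only [G, ← hua, map_sub, map_add, map_smul, hv]
      simp only [smul_eq_mul, mul_one]
      module
    have h2 : a + t • v = a := by
      have ha' : H (G a) = a := ha
      have hat' : H (G (a + t • v)) = a + t • v := hat
      rw [← hat', this, ha']
    have h3 : t • v = 0 := by simpa using h2
    exact (smul_eq_zero.1 h3).resolve_right hv0

/-- directional derivative -/
noncomputable def dirD (v : E) (u : E → ℂ) : E → ℂ := fun x => fderiv ℂ u x v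

lemma dirD_diff {U : Set E} (hU : IsOpen U) (v : E) {u : E → ℂ} (hu : DifferentiableOn ℂ u U) :
    DifferentiableOn ℂ (dirD v u) U := 
  (differentiableOn_fderiv hU hu).clm_apply (differentiableOn_const v)

lemma dirD_iter_diff {U : Set E} (hU : IsOpen U) (v : E) {u : E → ℂ} (hu : DifferentiableOn ℂ u U)
    (k : ℕ) : DifferentiableOn ℂ ((dirD v)^[k] u) U := by
  induction k with
  | zero => exact hu
  | succ k ih => rw [Function.iterate_succ_apply']; exact dirD_diff hU v ih

lemma slice_hasDerivAt {U : Set E} (hU : IsOpen U) (v x : E) {u : E → ℂ}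
    (hu : DifferentiableOn ℂ u U) {t : ℂ} (ht : x + t • v ∈ U) :
    HasDerivAt (fun t : ℂ => u (x + t • v)) (dirD v u (x + t • v)) t := by
  have h1 : HasFDerivAt u (fderiv ℂ u (x + t • v)) (x + t • v) :=
    (hu.differentiableAt (hU.mem_nhds ht)).hasFDerivAt
  have h2 : HasDerivAt (fun t : ℂ => x + t • v) v t := by
    simpa using ((hasDerivAt_id t).smul_const v).const_add x
  exact h1.comp_hasDerivAt t h2

lemma isOpen_slice {U : Set E} (hU : IsOpen U) (v x : E) : IsOpen {t : ℂ | x + t • v ∈ U} :=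
  hU.preimage (by fun_prop)

lemma slice_iteratedDeriv {U : Set E} (hU : IsOpen U) (v x : E) {u : E → ℂ}
    (hu : DifferentiableOn ℂ u U) (k : ℕ) : ∀ t : ℂ, x + t • v ∈ U →
    iteratedDeriv k (fun t : ℂ => u (x + t • v)) t = (dirD v)^[k] u (x + t • v) := by
  induction k with
  | zero => intro t _; simp
  | succ k ih =>
    intro t ht
    rw [iteratedDeriv_succ, Function.iterate_succ_apply']
    have : iteratedDeriv k (fun t : ℂ => u (x + t • v)) =ᶠ[𝓝 t]
        fun t => (dirD v)^[k] u (x + t • v) := by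
      filter_upwards [(isOpen_slice hU v x).mem_nhds ht] with s hs using ih s hs
    rw [this.deriv_eq]
    exact (slice_hasDerivAt hU v x (dirD_iter_diff hU v hu k) ht).deriv

lemma slice_diff {U : Set E} (hU : IsOpen U) (v x : E) {u : E → ℂ}
    (hu : DifferentiableOn ℂ u U) :
    DifferentiableOn ℂ (fun t : ℂ => u (x + t • v)) {t : ℂ | x + t • v ∈ U} := 
  fun _ ht => (slice_hasDerivAt hU v x hu ht).differentiableAt.differentiableWithinAt

lemma slice_analyticAt {U : Set E} (hU : IsOpen U) (v x : E) {u : E → ℂ}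
    (hu : DifferentiableOn ℂ u U) {t : ℂ} (ht : x + t • v ∈ U) :
    AnalyticAt ℂ (fun t : ℂ => u (x + t • v)) t := 
  (slice_diff hU v x hu).analyticAt ((isOpen_slice hU v x).mem_nhds ht)

lemma slice_zero {U : Set E} (hU : IsOpen U) (v x : E) {u : E → ℂ}
    (hu : DifferentiableOn ℂ u U) (hx : x ∈ U) (h : ∀ k, (dirD v)^[k] u x = 0) :
    ∀ᶠ t in 𝓝 (0:ℂ), u (x + t • v) = 0 := by
  have hx' : x + (0:ℂ) • v ∈ U := by simpa using hx
  have ha := slice_analyticAt hU v x hu hx'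
  rw [← analyticOrderAt_eq_top]
  refine ENat.eq_top_iff_forall_ge.2 fun m => ?_
  rw [natCast_le_analyticOrderAt_iff_iteratedDeriv_eq_zero ha]
  intro i _
  rw [slice_iteratedDeriv hU v x hu i 0 hx']
  simpa using h i

lemma slice_ne_zero {U : Set E} (hU : IsOpen U) (v x : E) {u : E → ℂ}
    (hu : DifferentiableOn ℂ u U) (hx : x ∈ U) {k : ℕ} (h : (dirD v)^[k] u x ≠ 0) :
    ∀ᶠ t in 𝓝[≠] (0:ℂ), u (x + t • v) ≠ 0 := by
  have hx' : x + (0:ℂ) • v ∈ U := by simpa using hx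
  have ha := slice_analyticAt hU v x hu hx'
  refine ha.eventually_eq_zero_or_eventually_ne_zero.resolve_left fun h0 => h ?_
  have h1 := slice_iteratedDeriv hU v x hu k 0 hx'
  have h2 : (fun t : ℂ => u (x + t • v)) =ᶠ[𝓝 0] fun _ => 0 := h0
  rw [h2.iteratedDeriv_eq] at h1
  simpa using h1.symm

lemma zero_of_slices {p : E} {R : ℝ} {u : E → ℂ}
    (hu : DifferentiableOn ℂ u (ball p R))
    (h : ∀ v, ∀ᶠ t in 𝓝 (0:ℂ), u (p + t • v) = 0) : ∀ y ∈ ball p R, u y = 0 := by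
  intro y hy
  set v := y - p
  have hmem : ∀ t : ℂ, p + t • v ∈ ball p R ↔ ‖t‖ * ‖v‖ < R := by
    intro t; simp [norm_smul]
  have hvR : ‖v‖ < R := by rwa [mem_ball, dist_eq_norm] at hy
  have hc : Convex ℝ {t : ℂ | p + t • v ∈ ball p R} := by
    intro a ha b hb s t hs ht hst
    have ha := (hmem a).1 ha
    have hb := (hmem b).1 hb
    refine (hmem _).2 ?_
    have h1 : ‖s • a + t • b‖ ≤ s * ‖a‖ + t * ‖b‖ := by
      refine (norm_add_le _ _).trans ?_
      rw [norm_smul, norm_smul, Real.norm_of_nonneg hs, Real.norm_of_nonneg ht]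
    calc ‖s • a + t • b‖ * ‖v‖ ≤ (s * ‖a‖ + t * ‖b‖) * ‖v‖ := by gcongr
      _ = s * (‖a‖ * ‖v‖) + t * (‖b‖ * ‖v‖) := by ring
      _ < R := by
        rcases hs.eq_or_lt with rfl | hs'
        · simp at hst; subst hst; simpa using hb
        · have q1 := mul_lt_mul_of_pos_left ha hs'
          have q2 := mul_le_mul_of_nonneg_left hb.le ht
          have q3 : s * R + t * R = R := by rw [← add_mul, hst, one_mul]
          linarith
  have hA : AnalyticOnNhd ℂ (fun t : ℂ => u (p + t • v)) {t : ℂ | p + t • v ∈ ball p R} :=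
    fun t ht => slice_analyticAt isOpen_ball v p hu ht
  have := hA.eqOn_zero_of_preconnected_of_eventuallyEq_zero hc.isPreconnected (z₀ := 0)
    ((hmem 0).2 (by simpa using (norm_nonneg v).trans_lt hvR)) (h v)
    (x := 1) ((hmem 1).2 (by simpa using hvR))
  simpa [v] using this
end

open Metric Filter Topology Set

def Osg.{u} (n : ℕ) : Prop := ∀ (E : Type u) [NormedAddCommGroup E] [NormedSpace ℂ E]
  [FiniteDimensional ℂ E], Module.finrank ℂ E = n → ∀ (f : E → E) (U : Set E), IsOpen U →
  DifferentiableOn ℂ f U → InjOn f U → ∀ p ∈ U, ∀ w, fderiv ℂ f p w = 0 → w = 0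

lemma finrank_ker_fun {E : Type*} [NormedAddCommGroup E] [NormedSpace ℂ E] [FiniteDimensional ℂ E]
    {n : ℕ} (hn : Module.finrank ℂ E = n + 1) (l : E →L[ℂ] ℂ) (v : E) (hv : l v = 1) :
    Module.finrank ℂ (LinearMap.ker (l : E →ₗ[ℂ] ℂ)) = n := by
  have h1 := LinearMap.finrank_range_add_finrank_ker (l : E →ₗ[ℂ] ℂ)
  have h2 : LinearMap.range (l : E →ₗ[ℂ] ℂ) = ⊤ := by
    rw [LinearMap.range_eq_top]
    intro c
    exact ⟨c • v, by simp [hv]⟩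
  rw [h2, finrank_top, Module.finrank_self, hn] at h1
  omega

lemma osgood_caseA.{u} {n : ℕ} (IH : Osg.{u} n) {E : Type u} [NormedAddCommGroup E]
    [NormedSpace ℂ E] [FiniteDimensional ℂ E] (hn : Module.finrank ℂ E = n + 1) {f : E → E}
    {U : Set E} (hU : IsOpen U) (hf : DifferentiableOn ℂ f U) (hi : InjOn f U) {p : E} (hp : p ∈ U)
    (h0 : fderiv ℂ f p ≠ 0) : ∀ w, fderiv ℂ f p w = 0 → w = 0 := by
  obtain ⟨v, hv⟩ : ∃ v, fderiv ℂ f p v ≠ 0 := by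
    by_contra! h
    exact h0 (by ext w; simp [h w])
  obtain ⟨l0, hl0⟩ := SeparatingDual.exists_eq_one (R := ℂ) hv
  have hfp : HasFDerivAt f (fderiv ℂ f p) p := (hf.differentiableAt (hU.mem_nhds hp)).hasFDerivAt
  let u : E → ℂ := fun x => l0 (f x - f p)
  have hu : DifferentiableOn ℂ u U := by
    exact l0.differentiable.comp_differentiableOn (hf.sub_const _)
  have hu' : fderiv ℂ u p = l0.comp (fderiv ℂ f p) :=
    (l0.hasFDerivAt.comp p (hfp.sub_const _)).fderiv
  obtain ⟨⟨H, r, hr, hHd, hH0, hHU, hHu, hHi, hH'⟩, -⟩ :=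
    straighten hU hu hp (by simp [u]) (v := v) (by rw [hu']; simpa using hl0)
  rw [hu'] at hHu
  set l : E →L[ℂ] ℂ := l0.comp (fderiv ℂ f p) with hl
  let K := LinearMap.ker (l : E →ₗ[ℂ] ℂ)
  let L := LinearMap.ker (l0 : E →ₗ[ℂ] ℂ)
  have hK : Module.finrank ℂ K = n := finrank_ker_fun hn l v (by simpa [hl] using hl0)
  have hL : Module.finrank ℂ L = n := finrank_ker_fun hn l0 _ hl0
  let e : L ≃ₗ[ℂ] K := LinearEquiv.ofFinrankEq L K (hL.trans hK.symm)
  obtain ⟨π, hπ⟩ := LinearMap.exists_extend (e : L →ₗ[ℂ] K)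
  let P : E →L[ℂ] K := LinearMap.toContinuousLinearMap π
  have hP : ∀ x (hx : x ∈ L), P x = e ⟨x, hx⟩ := by
    intro x hx
    exact LinearMap.congr_fun hπ ⟨x, hx⟩
  let F : K → K := fun k => P (f (H k) - f p)
  have hball : ∀ k : K, k ∈ ball (0:K) r → (k:E) ∈ ball (0:E) r := by
    intro k hk; simpa using hk
  have hFd : DifferentiableOn ℂ F (ball 0 r) := by
    refine P.differentiable.comp_differentiableOn (DifferentiableOn.sub_const ?_ _)
    refine hf.comp (t := U) (hHd.comp (t := ball 0 r) K.subtypeL.differentiableOn ?_) ?_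
    · intro k hk; exact hball k hk
    · intro k hk; exact hHU (hball k hk)
  have hmemL : ∀ k : K, k ∈ ball (0:K) r → f (H k) - f p ∈ L := by
    intro k hk
    have := hHu k (hball k hk)
    have hk0 : l k = 0 := k.2
    rw [hk0] at this
    exact this
  have hFi : InjOn F (ball 0 r) := by
    intro k hk k' hk' h
    simp only [F] at h
    rw [hP _ (hmemL k hk), hP _ (hmemL k' hk')] at h
    have h1 := e.injective h
    have h2 : f (H k) = f (H k') := by simpa using h1
    exact Subtype.ext (hHi (hball _ hk) (hball _ hk') (hi (hHU (hball _ hk)) (hHU (hball _ hk')) h2))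
  have hF' : HasFDerivAt F (P.comp ((fderiv ℂ f p).comp K.subtypeL)) 0 := by
    have h1 : HasFDerivAt (fun k : K => H k) ((ContinuousLinearMap.id ℂ E).comp K.subtypeL) 0 := by
      refine HasFDerivAt.comp (g := H) (f := fun k : K => (k:E)) (0:K) ?_ K.subtypeL.hasFDerivAt
      simpa using hH'
    have h2 : HasFDerivAt (fun k : K => f (H k)) ((fderiv ℂ f p).comp ((ContinuousLinearMap.id ℂ E).comp K.subtypeL)) 0 := by
      refine HasFDerivAt.comp (g := f) (f := fun k : K => H k) (0:K) ?_ h1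
      simpa [hH0] using hfp
    exact P.hasFDerivAt.comp (0:K) (h2.sub_const _)
  intro w hw
  have hwK : w ∈ K := by
    change l0 (fderiv ℂ f p w) = 0
    rw [hw]; simp
  have := IH K hK F (ball 0 r) isOpen_ball hFd hFi 0 (mem_ball_self hr) ⟨w, hwK⟩ (by
    rw [hF'.fderiv]; simp [hw])
  simpa using this

open Metric Filter Topology Set
set_option linter.unusedSectionVars false

lemma const_contra {X Y : Type*} [NormedAddCommGroup X] [NormedSpace ℂ X] [Nontrivial X]
    [NormedAddCommGroup Y] [NormedSpace ℂ Y] {F : X → Y} {p : X} {R : ℝ} (hR : 0 < R)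
    (hF : ∀ y ∈ ball p R, HasFDerivAt F (0 : X →L[ℂ] Y) y) (hi : InjOn F (ball p R)) : False := by
  have hne : (𝓝[≠] p).NeBot := Module.punctured_nhds_neBot ℂ X p
  have h1 : ∀ᶠ y in 𝓝[≠] p, y ∈ ball p R := mem_nhdsWithin_of_mem_nhds (ball_mem_nhds p hR)
  obtain ⟨y, hy, hyp⟩ := (h1.and self_mem_nhdsWithin).exists
  have : F y = F p := by
    refine isOpen_ball.is_const_of_fderiv_eq_zero (𝕜 := ℂ) (convex_ball p R).isPreconnected
      (fun x hx => (hF x hx).differentiableAt.differentiableWithinAt)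
      (fun x hx => (hF x hx).fderiv) hy (mem_ball_self hR)
  exact hyp (hi hy (mem_ball_self hR) this)

section
variable {E : Type*} [NormedAddCommGroup E] [NormedSpace ℂ E] [FiniteDimensional ℂ E]

lemma slice_circle {U : Set E} (hU : IsOpen U) (v x : E) {u : E → ℂ}
    (hu : DifferentiableOn ℂ u U) (hne : ∀ᶠ t in 𝓝[≠] (0:ℂ), u (x + t • v) ≠ 0)
    (hx : U ∈ 𝓝 x) :
    ∃ ρ > 0, ∃ δ > 0, ∀ᶠ a in 𝓝 x, (∀ t ∈ closedBall (0:ℂ) ρ, a + t • v ∈ U) ∧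
      ∀ t ∈ sphere (0:ℂ) ρ, δ ≤ ‖u (a + t • v)‖ := by
  have hcont : Continuous (fun q : E × ℂ => q.1 + q.2 • v) := by fun_prop
  have hc1 : Continuous (fun t : ℂ => x + t • v) := by fun_prop
  have hev : ∀ᶠ t in 𝓝 (0:ℂ), x + t • v ∈ U :=
    hc1.continuousAt.eventually (by simpa using hx)
  rw [eventually_nhdsWithin_iff] at hne
  obtain ⟨ρ₀, hρ₀, hb⟩ := Metric.eventually_nhds_iff_ball.1 (hne.and hev)
  have hρ : 0 < ρ₀ / 2 := by positivity
  have hsub : ∀ t ∈ closedBall (0:ℂ) (ρ₀/2), t ∈ ball (0:ℂ) ρ₀ := fun t ht =>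
    closedBall_subset_ball (by linarith) ht
  have huc : ContinuousOn (fun t : ℂ => ‖u (x + t • v)‖) (sphere 0 (ρ₀/2)) := by
    refine (hu.continuousOn.comp hc1.continuousOn ?_).norm
    intro t ht
    exact (hb t (hsub t (sphere_subset_closedBall ht))).2
  have hsne : (sphere (0:ℂ) (ρ₀/2)).Nonempty := NormedSpace.sphere_nonempty.2 hρ.le
  obtain ⟨t0, ht0, hmin⟩ := (isCompact_sphere (0:ℂ) (ρ₀/2)).exists_isMinOn hsne huc
  have hpos : 0 < ‖u (x + t0 • v)‖ := by
    rw [norm_pos_iff]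
    refine (hb t0 (hsub t0 (sphere_subset_closedBall ht0))).1 ?_
    rintro rfl
    simp at ht0
    linarith
  refine ⟨ρ₀/2, hρ, ‖u (x + t0 • v)‖ / 2, by positivity, ?_⟩
  have e1 : ∀ᶠ a in 𝓝 x, ∀ t ∈ closedBall (0:ℂ) (ρ₀/2), a + t • v ∈ U := by
    refine (isCompact_closedBall (0:ℂ) (ρ₀/2)).eventually_forall_of_forall_eventually ?_
    intro t ht
    exact hcont.continuousAt.eventually (hU.mem_nhds (hb t (hsub t ht)).2)
  have e2 : ∀ᶠ a in 𝓝 x, ∀ t ∈ sphere (0:ℂ) (ρ₀/2),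
      ‖u (x + t0 • v)‖ / 2 ≤ ‖u (a + t • v)‖ := by
    refine (isCompact_sphere (0:ℂ) (ρ₀/2)).eventually_forall_of_forall_eventually ?_
    intro t ht
    have hm : x + t • v ∈ U := (hb t (hsub t (sphere_subset_closedBall ht))).2
    have hca : ContinuousAt (fun q : E × ℂ => ‖u (q.1 + q.2 • v)‖) (x, t) := by
      refine ContinuousAt.norm (ContinuousAt.comp (g := u) (f := fun q : E × ℂ => q.1 + q.2 • v) ?_ hcont.continuousAt)
      exact hu.continuousOn.continuousAt (hU.mem_nhds hm)
    have hge : ‖u (x + t0 • v)‖ ≤ ‖u (x + t • v)‖ := hmin ht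
    filter_upwards [hca.eventually (lt_mem_nhds (show ‖u (x + t0 • v)‖ / 2 < ‖u (x + t • v)‖ by linarith))] with q hq using hq.le
  exact e1.and e2

lemma det_ne_zero_of_inj {A : E →L[ℂ] E} (h : ∀ w, A w = 0 → w = 0) : A.det ≠ 0 := by
  have h1 : LinearMap.ker (A : E →ₗ[ℂ] E) = ⊥ := by
    rw [LinearMap.ker_eq_bot']; exact h
  intro h2
  have h3 := LinearMap.bot_lt_ker_of_det_eq_zero (f := (A : E →ₗ[ℂ] E)) h2
  rw [h1] at h3
  exact lt_irrefl _ h3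

lemma osgood_caseB (hn : 2 ≤ Module.finrank ℂ E) {f : E → E}
    {U : Set E} (hU : IsOpen U) (hf : DifferentiableOn ℂ f U) (hi : InjOn f U) {p : E} (hp : p ∈ U)
    (hA : ∀ q ∈ U, fderiv ℂ f q ≠ 0 → ∀ w, fderiv ℂ f q w = 0 → w = 0) : fderiv ℂ f p ≠ 0 := by
  intro h0p
  have : CompleteSpace E := FiniteDimensional.complete ℂ E
  have : Nontrivial E := Module.nontrivial_of_finrank_pos (R := ℂ) (by omega)
  let h : E → ℂ := fun x => (fderiv ℂ f x).det
  have hh : DifferentiableOn ℂ h U := Differentiable.comp_differentiableOn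
    (g := fun A : E →L[ℂ] E => A.det) (f := fderiv ℂ f)
    differentiable_det (differentiableOn_fderiv hU hf)
  have hZ : ∀ x ∈ U, h x = 0 → fderiv ℂ f x = 0 := by
    intro x hx h0
    by_contra hc
    exact det_ne_zero_of_inj (hA x hx hc) h0
  have hhp : h p = 0 := by
    simp only [h, h0p]
    change LinearMap.det (0 : E →ₗ[ℂ] E) = 0
    rw [LinearMap.det_zero]
    exact zero_pow (by omega)
  obtain ⟨R, hR, hRU⟩ := Metric.isOpen_iff.1 hU p hp
  have hfd : ∀ x ∈ U, HasFDerivAt f (fderiv ℂ f x) x := fun x hx =>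
    (hf.differentiableAt (hU.mem_nhds hx)).hasFDerivAt
  have step1 : ∃ v : E, ∃ k : ℕ, ∃ x ∈ ball p R, h x = 0 ∧ (dirD v)^[k] h x ≠ 0 := by
    by_contra! hcon
    have hz : ∀ y ∈ ball p R, h y = 0 := zero_of_slices (hh.mono hRU) fun v =>
      slice_zero hU v p hh hp fun k => hcon v k p (mem_ball_self hR) hhp
    refine const_contra hR (F := f) (fun y hy => ?_) (hi.mono hRU)
    rw [← hZ y (hRU hy) (hz y hy)]
    exact hfd y (hRU hy)
  obtain ⟨v, hv⟩ := step1
  classical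
  set k0 := Nat.find hv with hk0
  obtain ⟨x0, hx0, hhx0, hk⟩ := Nat.find_spec hv
  rw [← hk0] at hk
  obtain ⟨m, hm⟩ : ∃ m, k0 = m + 1 := by
    refine Nat.exists_eq_succ_of_ne_zero fun h0 => ?_
    rw [h0] at hk
    exact hk hhx0
  have hlt : ∀ x ∈ ball p R, h x = 0 → (dirD v)^[m] h x = 0 := by
    intro x hx hx'
    have := Nat.find_min hv (m := m) (by omega)
    push Not at this
    exact this x hx hx'
  let u := (dirD v)^[m] h
  have hu : DifferentiableOn ℂ u (ball p R) := dirD_iter_diff isOpen_ball v (hh.mono hRU) m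
  rw [hm, Function.iterate_succ_apply'] at hk
  set c := fderiv ℂ u x0 v with hc
  have hc0 : c ≠ 0 := hk
  obtain ⟨⟨H, r, hr, hHd, hH0, hHU, hHu, hHi, hH'⟩, N, hN, hNp⟩ :=
    straighten isOpen_ball hu hx0 (hlt x0 hx0 hhx0) (v := c⁻¹ • v) (by
      rw [map_smul, ← hc, smul_eq_mul, inv_mul_cancel₀ hc0])
  set l := fderiv ℂ u x0 with hl
  -- zero set of `u` near `x0` lies in `Z`
  have step3 : ∀ᶠ a in 𝓝 x0, u a = 0 → h a = 0 := by
    let V := ball p R ∩ interior N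
    have hVo : IsOpen V := isOpen_ball.inter isOpen_interior
    have hxV : x0 ∈ V := ⟨hx0, mem_interior_iff_mem_nhds.2 hN⟩
    have hhV : DifferentiableOn ℂ h V := (hh.mono hRU).mono inter_subset_left
    have hne : ∀ᶠ t in 𝓝[≠] (0:ℂ), h (x0 + t • v) ≠ 0 := by
      refine slice_ne_zero hU v x0 hh (hRU hx0) (k := m + 1) ?_
      rw [Function.iterate_succ_apply']
      exact hk
    obtain ⟨ρ, hρ, δ, hδ, hev⟩ := slice_circle hVo v x0 hhV hne (hVo.mem_nhds hxV)
    have hca : ∀ᶠ a in 𝓝 x0, ‖h a‖ < δ := by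
      have : ContinuousAt (fun a => ‖h a‖) x0 :=
        (hhV.continuousOn.continuousAt (hVo.mem_nhds hxV)).norm
      exact this.eventually (gt_mem_nhds (by simpa [hhx0] using hδ))
    filter_upwards [hev, hca, hVo.mem_nhds hxV] with a ha ha2 haV hua
    by_contra hha
    have hroot : ∃ t ∈ closedBall (0:ℂ) ρ, h (a + t • v) = 0 := by
      by_contra! hno
      have := min_modulus (g := fun t : ℂ => h (a + t • v)) hρ hδ
        ((slice_diff hVo v a hhV).mono ha.1) hno ha.2
      simp at this
      linarith
    obtain ⟨t, ht, hroot⟩ := hroot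
    have hmem := ha.1 t ht
    have hsm : (t * c) • c⁻¹ • v = t • v := by
      rw [smul_smul, mul_assoc, mul_inv_cancel₀ hc0, mul_one]
    have := hNp a (interior_subset haV.2) (t * c) (by rw [hsm]; exact interior_subset hmem.2) (by
      rw [hsm, hua]; exact (hlt _ hmem.1 hroot).symm)
    have ht0 : t = 0 := (mul_eq_zero.1 this).resolve_right hc0
    rw [ht0] at hroot
    exact hha (by simpa using hroot)
  have hHc : ContinuousAt H 0 := hH'.continuousAt
  have step4 : ∀ᶠ y in 𝓝 (0:E), u (H y) = 0 → h (H y) = 0 := by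
    rw [← hH0] at step3
    exact hHc.eventually step3
  obtain ⟨r1, hr1, hb1⟩ := Metric.eventually_nhds_iff_ball.1 (step4.and (ball_mem_nhds (0:E) hr))
  let K := LinearMap.ker (l : E →ₗ[ℂ] ℂ)
  have : Nontrivial K := by
    rw [Submodule.nontrivial_iff_ne_bot]
    exact LinearMap.ker_ne_bot_of_finrank_lt (by rw [Module.finrank_self]; omega)
  have hball : ∀ k : K, k ∈ ball (0:K) r1 → (k:E) ∈ ball (0:E) r1 := by
    intro k hk; simpa using hk
  refine const_contra (X := K) (F := fun k : K => f (H k)) (p := 0) hr1 ?_ ?_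
  · intro k hk
    have hk1 := hb1 _ (hball k hk)
    have h1 : u (H k) = 0 := by
      rw [hHu _ hk1.2]; exact k.2
    have h2 := hZ _ (hRU (hHU hk1.2)) (hk1.1 h1)
    have h3 := hfd _ (hRU (hHU hk1.2))
    rw [h2] at h3
    have h4 : HasFDerivAt H (fderiv ℂ H k) (k:E) :=
      (hHd.differentiableAt (isOpen_ball.mem_nhds hk1.2)).hasFDerivAt
    have h5 := HasFDerivAt.comp (g := H) (f := fun k : K => (k:E)) k h4 K.subtypeL.hasFDerivAt
    have h6 := HasFDerivAt.comp (g := f) (f := fun k : K => H k) k h3 h5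
    rw [ContinuousLinearMap.zero_comp] at h6
    exact h6
  · intro k hk k' hk' h
    have hk1 := (hb1 _ (hball k hk)).2
    have hk1' := (hb1 _ (hball k' hk')).2
    exact Subtype.ext (hHi hk1 hk1' (hi (hRU (hHU hk1)) (hRU (hHU hk1')) h))

end

lemma osgood_one {E : Type*} [NormedAddCommGroup E] [NormedSpace ℂ E] [FiniteDimensional ℂ E]
    (hn : Module.finrank ℂ E = 1) {f : E → E}
    {U : Set E} (hU : IsOpen U) (hf : DifferentiableOn ℂ f U) (hi : InjOn f U) {p : E}
    (hp : p ∈ U) : fderiv ℂ f p ≠ 0 := by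
  intro h0
  let e : E ≃L[ℂ] ℂ := ContinuousLinearEquiv.ofFinrankEq (by rw [hn, Module.finrank_self])
  have := inj_deriv_ne_zero (f := fun t => e (f (e.symm t))) (U := e.symm ⁻¹' U) (p := e p)
    (hU.preimage e.symm.continuous) ?_ ?_ (by simpa using hp)
  · apply this
    have h1 : HasFDerivAt f (0 : E →L[ℂ] E) (e.symm (e p)) := by
      rw [← h0]; simpa using (hf.differentiableAt (hU.mem_nhds hp)).hasFDerivAt
    have h2 := h1.comp (e p) e.symm.hasFDerivAt
    have h3 := e.hasFDerivAt.comp (e p) h2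
    have h4 := h3.hasDerivAt
    exact h4.deriv.trans (by simp)
  · exact e.differentiable.comp_differentiableOn
      (hf.comp e.symm.differentiable.differentiableOn (fun t ht => ht))
  · intro a ha b hb h
    exact e.symm.injective (hi ha hb (e.injective h))

lemma osgood_all.{u} (n : ℕ) : Osg.{u} n := by
  induction n with
  | zero =>
    intro E _ _ _ hn f U hU hf hi p hp w hw
    have := Module.finrank_zero_iff.1 hn
    exact Subsingleton.elim _ _
  | succ n ih =>
    intro E _ _ _ hn f U hU hf hi p hp
    refine osgood_caseA ih hn hU hf hi hp ?_
    rcases Nat.eq_zero_or_pos n with rfl | hpos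
    · exact osgood_one hn hU hf hi hp
    · exact osgood_caseB (by omega) hU hf hi hp fun q hq => osgood_caseA ih hn hU hf hi hq

lemma osgood {E : Type*} [NormedAddCommGroup E] [NormedSpace ℂ E] [FiniteDimensional ℂ E]
    {f : E → E} {U : Set E} (hU : IsOpen U) (hf : DifferentiableOn ℂ f U) (hi : InjOn f U) {p : E}
    (hp : p ∈ U) : (fderiv ℂ f p).det ≠ 0 :=
  det_ne_zero_of_inj (osgood_all _ E rfl f U hU hf hi p hp)

open Metric Filter Topology Set
set_option linter.unusedSectionVars false

section
variable {ι E : Type*} [NormedAddCommGroup E] [NormedSpace ℂ E] [FiniteDimensional ℂ E]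

lemma hurwitz {l : Filter ι} [l.NeBot] {h : ι → E → ℂ} {g : E → ℂ} {U : Set E} (hU : IsOpen U)
    (hUc : IsPreconnected U) (hc : HolConv l h g U) (hnz : ∀ᶠ n in l, ∀ x ∈ U, h n x ≠ 0)
    {z0 : E} (hz0 : z0 ∈ U) (hg0 : g z0 ≠ 0) : ∀ x ∈ U, g x ≠ 0 := by
  have hg : DifferentiableOn ℂ g U := hc.differentiableOn
  have claim : ∀ x ∈ U, g x = 0 → ∀ᶠ y in 𝓝 x, g y = 0 := by
    intro x hx hgx
    obtain ⟨R, hR, M, h1, h2, h3⟩ := hc x hx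
    have hu := local_unif hR h2 h3
    have hsub : ball x (R/2) ⊆ ball x R := ball_subset_ball (by linarith)
    have hR2 : 0 < R/2 := by positivity
    have hgb : DifferentiableOn ℂ g (ball x (R/2)) := hg.mono (hsub.trans h1)
    have hz : ∀ y ∈ ball x (R/2), g y = 0 := by
      refine zero_of_slices hgb fun v => ?_
      refine (slice_analyticAt isOpen_ball v x hgb (t := 0)
        (by simpa using hR2)).eventually_eq_zero_or_eventually_ne_zero.resolve_right fun hne => ?_
      obtain ⟨ρ, hρ, δ, hδ, hev⟩ := slice_circle isOpen_ball v x hgb hne (ball_mem_nhds x hR2)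
      have hev := hev.self_of_nhds
      rw [Metric.tendstoUniformlyOn_iff] at hu
      obtain ⟨n, hn1, hn2, hn3⟩ := (h2.and ((hu (δ/2) (by positivity)).and hnz)).exists
      have hmm := min_modulus (g := fun t : ℂ => h n (x + t • v)) hρ (δ := δ/2) (by positivity)
        ((slice_diff isOpen_ball v x (hn1.1.mono hsub)).mono hev.1)
        (fun t ht => hn3 _ (h1 (hsub (hev.1 t ht)))) (fun t ht => by
          have q1 := hn2 _ (hev.1 t (sphere_subset_closedBall ht))
          have q2 := hev.2 t ht
          rw [dist_eq_norm] at q1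
          have q3 := norm_sub_norm_le (g (x + t • v)) (h n (x + t • v))
          linarith)
      have q1 := hn2 x (mem_ball_self hR2)
      rw [dist_eq_norm, hgx, zero_sub, norm_neg] at q1
      simp at hmm
      linarith
    filter_upwards [ball_mem_nhds x hR2] with y hy using hz y hy
  intro x hx hgx
  obtain ⟨y, -, hy1, hy2⟩ := hUc {y | y ∈ U ∧ g y = 0} {y | y ∈ U ∧ g y ≠ 0}
    (isOpen_iff_mem_nhds.2 fun y hy => (hU.eventually_mem hy.1).and (claim y hy.1 hy.2))
    (isOpen_iff_mem_nhds.2 fun y hy => (hU.eventually_mem hy.1).and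
      ((hg.continuousOn.continuousAt (hU.mem_nhds hy.1)).eventually_ne hy.2))
    (fun y hy => by by_cases h : g y = 0 <;> simp [hy, h])
    ⟨x, hx, hx, hgx⟩ ⟨z0, hz0, hz0, hg0⟩
  exact hy2.2 hy1.2

lemma rouche {l : Filter ι} [l.NeBot] {f : ι → E → E} {g : E → E} {U : Set E}
    (hc : HolConv l f g U) {a : E} (ha : a ∈ U) (hd : (fderiv ℂ g a).det ≠ 0) {ε : ℝ}
    (hε : 0 < ε) : ∀ᶠ n in l, g a ∈ f n '' ball a ε := by
  have : CompleteSpace E := FiniteDimensional.complete ℂ E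
  rcases subsingleton_or_nontrivial E with hs | hs
  · exact Eventually.of_forall fun n => ⟨a, mem_ball_self hε, Subsingleton.elim _ _⟩
  let A : E ≃L[ℂ] E := (fderiv ℂ g a).toContinuousLinearEquivOfDetNeZero hd
  have hA : (A : E →L[ℂ] E) = fderiv ℂ g a :=
    ContinuousLinearMap.coe_toContinuousLinearEquivOfDetNeZero _ _
  have hN : 0 < ‖(A.symm : E →L[ℂ] E)‖₊ := A.nnnorm_symm_pos
  set N := ‖(A.symm : E →L[ℂ] E)‖₊ with hNdef
  let c : NNReal := N⁻¹ / 2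
  have hc0 : 0 < (c:ℝ) := by simp only [c]; positivity
  obtain ⟨R, hR, M, h1, h2, h3⟩ := hc a ha
  have hu := (local_unif_fderiv hR h2 h3).1
  rw [Metric.tendstoUniformlyOn_iff] at hu
  have hgd : DifferentiableOn ℂ g (ball a R) := (hc.mono isOpen_ball h1).differentiableOn
  have hcont : ContinuousAt (fderiv ℂ g) a :=
    (differentiableOn_fderiv isOpen_ball hgd).continuousOn.continuousAt (ball_mem_nhds a hR)
  obtain ⟨s0, hs0, hb⟩ := Metric.eventually_nhds_iff_ball.1
    (hcont.eventually (ball_mem_nhds (fderiv ℂ g a) (ε := (c:ℝ)/2) (by positivity)))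
  obtain ⟨s, hs, hs1, hs2, hs3⟩ : ∃ s > 0, s ≤ s0 ∧ s ≤ R/4 ∧ s ≤ ε :=
    ⟨min s0 (min (R/4) ε), by positivity, by simp, by simp, by simp⟩
  have hNc : ((N:ℝ)⁻¹ - c) * (s/2) > 0 := by
    have : (c:ℝ) = (N:ℝ)⁻¹/2 := by simp [c]
    rw [this]
    have : (0:ℝ) < (N:ℝ)⁻¹ := by positivity
    nlinarith
  have hta := h3 a (mem_ball_self hR)
  filter_upwards [h2, hu (c/2) (by positivity), hta.eventually (ball_mem_nhds _ hNc)]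
    with n hn1 hn2 hn3
  have hap : ApproximatesLinearOn (f n) (A : E →L[ℂ] E) (ball a s) c := by
    intro x hx y hy
    refine (convex_ball a s).norm_image_sub_le_of_norm_fderiv_le' (𝕜 := ℂ) (fun w hw => ?_)
      (fun w hw => ?_) hy hx
    · exact hn1.1.differentiableAt (isOpen_ball.mem_nhds (ball_subset_ball (by linarith) hw))
    · have q1 := hn2 w (ball_subset_ball hs2 hw)
      have q2 := hb w (ball_subset_ball hs1 hw)
      rw [dist_eq_norm] at q1
      rw [dist_eq_norm] at q2
      rw [hA]
      have q3 : fderiv ℂ (f n) w - fderiv ℂ g a =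
        (fderiv ℂ g w - fderiv ℂ g a) - (fderiv ℂ g w - fderiv ℂ (f n) w) := by abel
      rw [q3]
      refine (norm_sub_le _ _).trans ?_
      linarith
  have hsurj := hap.surjOn_closedBall_of_nonlinearRightInverse A.toNonlinearRightInverse
    (b := a) (ε := s/2) (by positivity) (closedBall_subset_ball (by linarith))
  obtain ⟨x, hx, hxe⟩ := hsurj (a := g a) (by
    rw [mem_closedBall, dist_comm]
    exact (mem_ball.1 hn3).le)
  exact ⟨x, closedBall_subset_ball (by linarith) hx, hxe⟩

lemma open_image {f : E → E} {U : Set E} (hU : IsOpen U) (hf : DifferentiableOn ℂ f U)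
    (hd : ∀ x ∈ U, (fderiv ℂ f x).det ≠ 0) : IsOpen (f '' U) := by
  have : CompleteSpace E := FiniteDimensional.complete ℂ E
  rw [isOpen_iff_mem_nhds]
  rintro _ ⟨x, hx, rfl⟩
  have h1 := contDiffAt_of_hol hU hf hx
  have h2 : HasFDerivAt f (((fderiv ℂ f x).toContinuousLinearEquivOfDetNeZero (hd x hx) : E ≃L[ℂ] E) : E →L[ℂ] E) x := by
    rw [ContinuousLinearMap.coe_toContinuousLinearEquivOfDetNeZero]
    exact (hf.differentiableAt (hU.mem_nhds hx)).hasFDerivAt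
  have h3 := h1.hasStrictFDerivAt' h2 one_ne_zero
  rw [← h3.map_nhds_eq_of_equiv]
  exact image_mem_map (hU.mem_nhds hx)

lemma hol_inverse {f : E → E} {U : Set E} (hU : IsOpen U) (hf : DifferentiableOn ℂ f U)
    (hi : InjOn f U) {ψ : E → E} (hψ : ∀ y ∈ f '' U, ψ y ∈ U ∧ f (ψ y) = y) :
    ∀ y ∈ f '' U, DifferentiableAt ℂ ψ y ∧
      (fderiv ℂ f (ψ y)).comp (fderiv ℂ ψ y) = ContinuousLinearMap.id ℂ E := by
  have : CompleteSpace E := FiniteDimensional.complete ℂ E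
  have hd : ∀ x ∈ U, (fderiv ℂ f x).det ≠ 0 := fun x hx => osgood hU hf hi hx
  rintro _ ⟨x, hx, rfl⟩
  have hψx : ψ (f x) = x := by
    have := hψ (f x) ⟨x, hx, rfl⟩
    exact hi this.1 hx this.2
  have h1 := contDiffAt_of_hol hU hf hx
  set A : E ≃L[ℂ] E := (fderiv ℂ f x).toContinuousLinearEquivOfDetNeZero (hd x hx) with hAdef
  have hA : (A : E →L[ℂ] E) = fderiv ℂ f x :=
    ContinuousLinearMap.coe_toContinuousLinearEquivOfDetNeZero _ _
  have h2 : HasFDerivAt f (A : E →L[ℂ] E) x := by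
    rw [hA]
    exact (hf.differentiableAt (hU.mem_nhds hx)).hasFDerivAt
  have h3 := h1.hasStrictFDerivAt' h2 one_ne_zero
  have h4 := h3.to_localInverse.hasFDerivAt
  have h5 : h3.localInverse f A x (f x) = x := h3.localInverse_apply_image
  have h6 : ∀ᶠ y in 𝓝 (f x), h3.localInverse f A x y ∈ U := by
    refine h4.continuousAt.eventually (p := fun w => w ∈ U) ?_
    rw [h5]; exact hU.mem_nhds hx
  have h7 : ψ =ᶠ[𝓝 (f x)] h3.localInverse f A x := by
    filter_upwards [h6, h3.eventually_right_inverse] with y hy1 hy2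
    have := hψ y ⟨_, hy1, hy2⟩
    exact hi this.1 hy1 (this.2.trans hy2.symm)
  have h8 := h4.congr_of_eventuallyEq h7
  refine ⟨h8.differentiableAt, ?_⟩
  rw [h8.fderiv, hψx, ← hA]
  ext w
  simp
end

open Metric Filter Topology Set
set_option linter.unusedSectionVars false

section
variable {E : Type*} [NormedAddCommGroup E] [NormedSpace ℂ E] [FiniteDimensional ℂ E]

lemma ultralimit {ι : Type*} (l : Ultrafilter ι) {f : ι → E → E} {U : Set E} (hU : IsOpen U) {M : ℝ}
    (hb : ∀ᶠ n in (l : Filter ι), DifferentiableOn ℂ (f n) U ∧ ∀ y ∈ U, ‖f n y‖ ≤ M) :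
    ∃ g, HolConv (l : Filter ι) f g U := by
  have : ProperSpace E := FiniteDimensional.proper ℂ E
  have h : ∀ y, ∃ x, y ∈ U → Tendsto (fun n => f n y) l (𝓝 x) := by
    intro y
    by_cases hy : y ∈ U
    · obtain ⟨x, -, hx⟩ := (isCompact_closedBall (0:E) M).ultrafilter_le_nhds
        (l.map fun n => f n y) (by
          rw [le_principal_iff]
          change ∀ᶠ n in (l : Filter ι), f n y ∈ closedBall (0:E) M
          filter_upwards [hb] with n hn
          simpa using hn.2 y hy)
      exact ⟨x, fun _ => hx⟩
    · exact ⟨0, fun h => absurd h hy⟩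
  choose g hg using h
  refine ⟨g, fun x hx => ?_⟩
  obtain ⟨R, hR, hRU⟩ := Metric.isOpen_iff.1 hU x hx
  exact ⟨R, hR, M, hRU, hb.mono fun n hn => ⟨hn.1.mono hRU, fun y hy => hn.2 y (hRU hy)⟩,
    fun y hy => hg y (hRU hy)⟩

lemma core2 {ι : Type*} (l : Ultrafilter ι) {Ω : Set E} (hΩ : IsOpen Ω)
    (hbd : Bornology.IsBounded Ω) {z : E} (hz : z ∈ Ω) {φ : ι → E → E} {φ₀ : E → E}
    (hφ : ∀ n, DifferentiableOn ℂ (φ n) Ω ∧ InjOn (φ n) Ω ∧ φ n z = 0)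
    (hc : HolConv (l : Filter ι) φ φ₀ Ω) {r : ℝ} (hr : 0 < r)
    (hsub : ∀ᶠ n in (l : Filter ι), ball (0:E) r ⊆ φ n '' Ω) :
    (fderiv ℂ φ₀ z).det ≠ 0 ∧ ball (0:E) r ⊆ φ₀ '' Ω := by
  have : CompleteSpace E := FiniteDimensional.complete ℂ E
  obtain ⟨M, hM⟩ := hbd.exists_norm_le
  let ψ : ι → E → E := fun n => Function.invFunOn (φ n) Ω
  have hψ : ∀ n, ∀ y ∈ φ n '' Ω, ψ n y ∈ Ω ∧ φ n (ψ n y) = y := fun n y hy =>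
    ⟨Function.invFunOn_mem hy, Function.invFunOn_eq hy⟩
  have hinv := fun n => hol_inverse hΩ (hφ n).1 (hφ n).2.1 (hψ n)
  obtain ⟨ψ₀, hψc⟩ := ultralimit l (f := ψ) (U := ball (0:E) r) (M := M) isOpen_ball (by
    filter_upwards [hsub] with n hn
    exact ⟨fun y hy => (hinv n y (hn hy)).1.differentiableWithinAt,
      fun y hy => hM _ (hψ n y (hn hy)).1⟩)
  have h0r : (0:E) ∈ ball (0:E) r := mem_ball_self hr
  have hdet : ∀ n, ∀ y ∈ φ n '' Ω, (fderiv ℂ (φ n) (ψ n y)).det * (fderiv ℂ (ψ n) y).det = 1 := by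
    intro n y hy
    have := congrArg ContinuousLinearMap.det (hinv n y hy).2
    rw [ContinuousLinearMap.det, ContinuousLinearMap.det, ContinuousLinearMap.toLinearMap_comp,
      LinearMap.det_comp] at this
    rw [ContinuousLinearMap.det, ContinuousLinearMap.det, this]
    simp
  have hψ0 : ∀ n, ψ n 0 = z := by
    intro n
    have := hψ n 0 ⟨z, hz, (hφ n).2.2⟩
    exact (hφ n).2.1 this.1 hz (this.2.trans (hφ n).2.2.symm)
  have hprod : (fderiv ℂ φ₀ z).det * (fderiv ℂ ψ₀ 0).det = 1 := by
    have t1 := (hc.fderiv.det.tendsto z hz).mul (hψc.fderiv.det.tendsto 0 h0r)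
    refine tendsto_nhds_unique t1 (tendsto_const_nhds.congr fun n => ?_)
    rw [← hdet n 0 ⟨z, hz, (hφ n).2.2⟩, hψ0]
  refine ⟨left_ne_zero_of_mul_eq_one hprod, ?_⟩
  have hψd := hurwitz isOpen_ball (convex_ball (0:E) r).isPreconnected hψc.fderiv.det (by
    filter_upwards [hsub] with n hn y hy
    exact right_ne_zero_of_mul_eq_one (hdet n y (hn hy))) h0r (right_ne_zero_of_mul_eq_one hprod)
  intro y hy
  obtain ⟨ε, hε, hεr⟩ := Metric.isOpen_iff.1 isOpen_ball y hy
  have hmem : ψ₀ y ∈ Ω := by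
    obtain ⟨n, ⟨x, hx, hxe⟩, hn⟩ := ((rouche hψc hy (hψd y hy) hε).and hsub).exists
    rw [← hxe]
    exact (hψ n x (hn (hεr hx))).1
  refine ⟨ψ₀ y, hmem, ?_⟩
  have hcont : ContinuousAt φ₀ (ψ₀ y) :=
    hc.differentiableOn.continuousOn.continuousAt (hΩ.mem_nhds hmem)
  obtain ⟨s, hs, hsΩ, hu⟩ := hc.unif _ hmem
  have t2 : Tendsto (fun n => φ n (ψ n y)) l (𝓝 (φ₀ (ψ₀ y))) :=
    tendsto_comp_of_locally_uniform_limit hcont (hψc.tendsto y hy) fun u hu' =>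
      ⟨_, ball_mem_nhds _ hs, hu u hu'⟩
  refine tendsto_nhds_unique t2 (tendsto_const_nhds.congr' ?_)
  filter_upwards [hsub] with n hn
  exact (hψ n y (hn hy)).2.symm

lemma core [Nontrivial E] {Ω : Set E} (hΩ : IsOpen Ω) (hcn : IsPreconnected Ω)
    (hbd : Bornology.IsBounded Ω) {z : E} (hz : z ∈ Ω) {S : ℝ} (hS : 0 < S) {φ : ℕ → E → E}
    (hφ : ∀ n, DifferentiableOn ℂ (φ n) Ω ∧ InjOn (φ n) Ω ∧ MapsTo (φ n) Ω (ball 0 1) ∧ φ n z = 0)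
    (hsub : ∀ r < S, ∀ᶠ n in atTop, ball (0:E) r ⊆ φ n '' Ω) :
    ∃ g : E → E, DifferentiableOn ℂ g Ω ∧ InjOn g Ω ∧ MapsTo g Ω (ball 0 1) ∧ g z = 0 ∧
      ∀ r, 0 < r → r < S → ball (0:E) r ⊆ g '' Ω := by
  let l : Ultrafilter ℕ := hyperfilter ℕ
  have hl : (l : Filter ℕ) ≤ atTop := by
    rw [← Nat.cofinite_eq_atTop]; exact hyperfilter_le_cofinite
  obtain ⟨g, hg⟩ := ultralimit l (f := φ) (U := Ω) (M := 1) hΩ (Eventually.of_forall fun n =>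
    ⟨(hφ n).1, fun y hy => (mem_ball_zero_iff.1 ((hφ n).2.2.1 hy)).le⟩)
  have hc2 := fun r (hr : 0 < r) (hrS : r < S) => core2 l hΩ hbd hz
    (fun n => ⟨(hφ n).1, (hφ n).2.1, (hφ n).2.2.2⟩) hg hr (hl (hsub r hrS))
  have hgd := hg.differentiableOn
  have hdet : ∀ x ∈ Ω, (fderiv ℂ g x).det ≠ 0 := hurwitz hΩ hcn hg.fderiv.det
    (Eventually.of_forall fun n x hx => osgood hΩ (hφ n).1 (hφ n).2.1 hx) hz
    (hc2 (S/2) (by linarith) (by linarith)).1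
  refine ⟨g, hgd, ?_, ?_, ?_, fun r hr hrS => (hc2 r hr hrS).2⟩
  · intro a ha b hb hab
    by_contra hne
    have hd : 0 < dist a b := dist_pos.2 hne
    obtain ⟨ε₁, hε₁, h1⟩ := Metric.isOpen_iff.1 hΩ a ha
    obtain ⟨ε₂, hε₂, h2⟩ := Metric.isOpen_iff.1 hΩ b hb
    obtain ⟨ε, hε, he1, he2, he3⟩ : ∃ ε > 0, ε ≤ ε₁ ∧ ε ≤ ε₂ ∧ ε ≤ dist a b / 2 :=
      ⟨min ε₁ (min ε₂ (dist a b / 2)), by positivity, by simp, by simp, by simp⟩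
    obtain ⟨n, ⟨x, hx, hxe⟩, ⟨y, hy, hye⟩⟩ :=
      ((rouche hg ha (hdet a ha) hε).and (rouche hg hb (hdet b hb) hε)).exists
    have hxy : x = y := (hφ n).2.1 (h1 (ball_subset_ball he1 hx)) (h2 (ball_subset_ball he2 hy))
      (by rw [hxe, hye, hab])
    subst hxy
    have := dist_triangle_left a b x
    rw [mem_ball] at hx hy
    linarith
  · have hcl : g '' Ω ⊆ closedBall 0 1 := by
      rintro _ ⟨x, hx, rfl⟩
      refine isClosed_closedBall.mem_of_tendsto (hg.tendsto x hx) (Eventually.of_forall fun n => ?_)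
      exact ball_subset_closedBall ((hφ n).2.2.1 hx)
    have hgint := interior_maximal hcl (open_image hΩ hgd hdet)
    let _ : NormedSpace ℝ E := NormedSpace.restrictScalars ℝ ℂ E
    rw [interior_closedBall _ one_ne_zero] at hgint
    exact mapsTo_iff_image_subset.2 hgint
  · refine tendsto_nhds_unique (hg.tendsto z hz) (tendsto_const_nhds.congr fun n => ?_)
    rw [(hφ n).2.2.2]
end

open Metric Filter Topology Set

section
variable {q : ℕ} {Ω : Set (EuclideanSpace ℂ (Fin q))}

lemma sq_zero_case (hq : q = 0) (hne : Ω.Nonempty)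
    (φ : EuclideanSpace ℂ (Fin q) → EuclideanSpace ℂ (Fin q)) : SOmegaPhi q Ω φ = 0 := by
  subst hq
  obtain ⟨z, hz⟩ := hne
  rw [SOmegaPhi]
  refine Real.sSup_of_not_bddAbove ?_
  rintro ⟨B, hB⟩
  have := hB (a := |B| + 1) ⟨by positivity, fun y _ => ⟨z, hz, Subsingleton.elim _ _⟩⟩
  linarith [le_abs_self B]

lemma phi_le_one (hq : q ≠ 0) {φ : EuclideanSpace ℂ (Fin q) → EuclideanSpace ℂ (Fin q)}
    (hm : MapsTo φ Ω (ball 0 1)) {r : ℝ}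
    (hr : ball (0 : EuclideanSpace ℂ (Fin q)) r ⊆ φ '' Ω) : r ≤ 1 := by
  have : NeZero q := ⟨hq⟩
  have : Nontrivial (EuclideanSpace ℂ (Fin q)) := inferInstance
  by_contra! h
  obtain ⟨x, hx⟩ := (NormedSpace.sphere_nonempty (E := EuclideanSpace ℂ (Fin q)) (x := 0)
    (r := 1)).2 zero_le_one
  rw [mem_sphere_zero_iff_norm] at hx
  obtain ⟨y, hy, rfl⟩ := hr (by rw [mem_ball_zero_iff]; linarith : x ∈ _)
  have := mem_ball_zero_iff.1 (hm hy)
  linarith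

lemma phi_bdd (hq : q ≠ 0) {φ : EuclideanSpace ℂ (Fin q) → EuclideanSpace ℂ (Fin q)}
    (hm : MapsTo φ Ω (ball 0 1)) :
    BddAbove {r : ℝ | 0 < r ∧ ball (0 : EuclideanSpace ℂ (Fin q)) r ⊆ φ '' Ω} :=
  ⟨1, fun _ hr => phi_le_one hq hm hr.2⟩

lemma phi_nonempty (hopen : IsOpen Ω) {z : EuclideanSpace ℂ (Fin q)} (hz : z ∈ Ω)
    {φ : EuclideanSpace ℂ (Fin q) → EuclideanSpace ℂ (Fin q)}
    (hd : DifferentiableOn ℂ φ Ω) (hi : InjOn φ Ω) (h0 : φ z = 0) :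
    {r : ℝ | 0 < r ∧ ball (0 : EuclideanSpace ℂ (Fin q)) r ⊆ φ '' Ω}.Nonempty := by
  have ho : IsOpen (φ '' Ω) := open_image hopen hd fun x hx => osgood hopen hd hi hx
  obtain ⟨r, hr, h⟩ := Metric.isOpen_iff.1 ho 0 ⟨z, hz, h0⟩
  exact ⟨r, hr, h⟩

lemma exists_admissible (hbdd : Bornology.IsBounded Ω) (z : EuclideanSpace ℂ (Fin q)) :
    ∃ φ : EuclideanSpace ℂ (Fin q) → EuclideanSpace ℂ (Fin q),
      DifferentiableOn ℂ φ Ω ∧ InjOn φ Ω ∧ MapsTo φ Ω (ball 0 1) ∧ φ z = 0 := by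
  obtain ⟨M, hM0, hM⟩ := hbdd.subset_ball_lt 0 z
  have hMc : ((M : ℂ)⁻¹) ≠ 0 := by
    simpa using hM0.ne'
  refine ⟨fun x => ((M:ℂ)⁻¹) • (x - z), by fun_prop, ?_, ?_, by simp⟩
  · intro a _ b _ h
    have := smul_right_injective _ hMc h
    simpa using this
  · intro x hx
    have h1 := hM hx
    rw [mem_ball, dist_eq_norm] at h1
    rw [mem_ball_zero_iff, norm_smul, norm_inv, Complex.norm_real, Real.norm_of_nonneg hM0.le,
      inv_mul_lt_iff₀ hM0, mul_one]
    exact h1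

end

end

/-- The supremum defining the squeezing function of a bounded domain is attained:
there exists an injective holomorphic `φ : Ω → 𝔹^q` with `φ z = 0` and
`S_{Ω,φ}(z) = S_Ω(z)`. -/
theorem squeezing_function_attained (q : ℕ) (Ω : Set (EuclideanSpace ℂ (Fin q)))
    (hne : Ω.Nonempty) (hopen : IsOpen Ω) (hconn : IsConnected Ω)
    (hbdd : Bornology.IsBounded Ω)
    (z : EuclideanSpace ℂ (Fin q)) (hz : z ∈ Ω) :
    ∃ φ : EuclideanSpace ℂ (Fin q) → EuclideanSpace ℂ (Fin q),
      DifferentiableOn ℂ φ Ω ∧ Set.InjOn φ Ω ∧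
      Set.MapsTo φ Ω (ball (0 : EuclideanSpace ℂ (Fin q)) 1) ∧ φ z = 0 ∧
      SOmegaPhi q Ω φ = SOmega q Ω z := by
  by_cases hq : q = 0
  · have hz0 : ∀ x y : EuclideanSpace ℂ (Fin q), x = y := by
      subst hq
      exact fun x y => Subsingleton.elim x y
    refine ⟨fun _ => 0, by fun_prop, fun a _ b _ _ => hz0 a b, fun a _ => by simp, rfl, ?_⟩
    have hset : {s : ℝ | ∃ φ : EuclideanSpace ℂ (Fin q) → EuclideanSpace ℂ (Fin q),
        DifferentiableOn ℂ φ Ω ∧ Set.InjOn φ Ω ∧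
        Set.MapsTo φ Ω (ball (0 : EuclideanSpace ℂ (Fin q)) 1) ∧ φ z = 0 ∧
        s = SOmegaPhi q Ω φ} ⊆ {0} := by
      rintro s ⟨φ, -, -, -, -, rfl⟩
      exact sq_zero_case hq hne φ
    rw [sq_zero_case hq hne, SOmega]
    rcases Set.subset_singleton_iff_eq.1 hset with h | h <;> rw [h] <;> simp
  have : NeZero q := ⟨hq⟩
  have : Nontrivial (EuclideanSpace ℂ (Fin q)) := inferInstance
  rw [SOmega]
  set A := {s : ℝ | ∃ φ : EuclideanSpace ℂ (Fin q) → EuclideanSpace ℂ (Fin q),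
    DifferentiableOn ℂ φ Ω ∧ Set.InjOn φ Ω ∧
    Set.MapsTo φ Ω (ball (0 : EuclideanSpace ℂ (Fin q)) 1) ∧ φ z = 0 ∧
    s = SOmegaPhi q Ω φ} with hA
  have hAb : BddAbove A := by
    refine ⟨1, ?_⟩
    rintro s ⟨φ, hd, hi, hm, h0, rfl⟩
    exact csSup_le (phi_nonempty hopen hz hd hi h0) fun r hr => phi_le_one hq hm hr.2
  obtain ⟨φ₁, hd₁, hi₁, hm₁, h0₁⟩ := exists_admissible hbdd z
  have hA1 : SOmegaPhi q Ω φ₁ ∈ A := ⟨φ₁, hd₁, hi₁, hm₁, h0₁, rfl⟩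
  have hS : 0 < sSup A := by
    obtain ⟨r, hr⟩ := phi_nonempty hopen hz hd₁ hi₁ h0₁
    exact hr.1.trans_le ((le_csSup (phi_bdd hq hm₁) hr).trans (le_csSup hAb hA1))
  have hex : ∀ n : ℕ, ∃ φ : EuclideanSpace ℂ (Fin q) → EuclideanSpace ℂ (Fin q),
      (DifferentiableOn ℂ φ Ω ∧ Set.InjOn φ Ω ∧
      Set.MapsTo φ Ω (ball (0 : EuclideanSpace ℂ (Fin q)) 1) ∧ φ z = 0) ∧
      sSup A - 1 / ((n:ℝ) + 1) < SOmegaPhi q Ω φ := by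
    intro n
    obtain ⟨s, ⟨φ, hd, hi, hm, h0, rfl⟩, hs⟩ := exists_lt_of_lt_csSup ⟨_, hA1⟩
      (show sSup A - 1 / ((n:ℝ) + 1) < sSup A by
        have : 0 < 1 / ((n:ℝ) + 1) := by positivity
        linarith)
    exact ⟨φ, ⟨hd, hi, hm, h0⟩, hs⟩
  choose φ hφ hφS using hex
  obtain ⟨g, hd, hi, hm, h0, hr⟩ := core hopen hconn.isPreconnected hbdd hz hS hφ (by
    intro r hr
    have ht := tendsto_one_div_add_atTop_nhds_zero_nat (𝕜 := ℝ)
    filter_upwards [ht.eventually (gt_mem_nhds (sub_pos.2 hr))] with n hn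
    have h1 : r < SOmegaPhi q Ω (φ n) := lt_trans (by linarith) (hφS n)
    obtain ⟨s, hs, hrs⟩ := exists_lt_of_lt_csSup
      (phi_nonempty hopen hz (hφ n).1 (hφ n).2.1 (hφ n).2.2.2) h1
    exact (ball_subset_ball hrs.le).trans hs.2)
  refine ⟨g, hd, hi, hm, h0, le_antisymm (le_csSup hAb ⟨g, hd, hi, hm, h0, rfl⟩) ?_⟩
  refine le_of_forall_lt_imp_le_of_dense fun r hrS => ?_
  rcases le_or_gt r 0 with hr0 | hr0
  · exact hr0.trans (Real.sSup_nonneg fun s hs => hs.1.le)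
  · exact le_csSup (phi_bdd hq hm) ⟨hr0, hr r hr0 hrS⟩
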